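/- Let k, ℓ ≥ 2 be integers. For all natural numbers r < t and all real coefficients c_a (0 ≤ a < k^r), it is NOT the case that g_{k,ℓ}(k^t·n) = Σ_{0 ≤ a < k^r} c_a·g_{k,ℓ}(k^r·n + a) holds for all n ≥ 0. Consequently, the sequence (g_{k,ℓ}(n))_{n ≥ 0} is not strongly k-recursive. -/

import Mathlib

/-- For integers `k, ℓ ≥ 2`, `g k ℓ 0 = 1` and `g k ℓ n = 1 + ℓ ^ ⌊log_k n⌋` for `n > 0`. -/
def g (k ℓ : ℕ) (n : ℕ) : ℕ := if n = 0 then 1 else 1 + ℓ ^ Nat.log k n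

theorem g_pow_mul_pow_add {k : ℕ} (hk : 2 ≤ k) (ℓ r m : ℕ) {a : ℕ} (ha : a < k ^ r) :
    g k ℓ (k ^ r * k ^ m + a) = 1 + ℓ ^ (r + m) := by
  have hpos : 0 < k ^ (r + m) := by positivity
  have hle : k ^ r ≤ k ^ (r + m) := Nat.pow_le_pow_right (by omega) (by omega)
  have hlog : Nat.log k (k ^ (r + m) + a) = r + m := by
    refine Nat.log_eq_of_pow_le_of_lt_pow (by omega) ?_
    rw [pow_succ]
    nlinarith
  rw [← pow_add, g, if_neg (by omega), hlog]

theorem stmt_5 (k ℓ : ℕ) (hk : 2 ≤ k) (hℓ : 2 ≤ ℓ) (r t : ℕ) (hrt : r < t)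
    (c : ℕ → ℝ) :
    ¬ (∀ n : ℕ, (g k ℓ (k ^ t * n) : ℝ) =
        ∑ a ∈ Finset.range (k ^ r), c a * g k ℓ (k ^ r * n + a)) := by
  intro h
  have key (m : ℕ) : (1 + (ℓ : ℝ) ^ (t + m)) =
      (∑ a ∈ Finset.range (k ^ r), c a) * (1 + (ℓ : ℝ) ^ (r + m)) := by
    have hm := h (k ^ m)
    have ht : g k ℓ (k ^ t * k ^ m) = 1 + ℓ ^ (t + m) :=
      g_pow_mul_pow_add hk ℓ t m (a := 0) (by positivity)
    rw [ht, Finset.sum_congr rfl fun a ha => by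
      rw [g_pow_mul_pow_add hk ℓ r m (Finset.mem_range.mp ha)], ← Finset.sum_mul] at hm
    exact_mod_cast hm
  have h0 := key 0
  have h1 := key 1
  simp only [add_zero, pow_succ] at h0 h1
  have hl : (1 : ℝ) < ℓ := by exact_mod_cast hℓ
  have hlt : (ℓ : ℝ) ^ r < (ℓ : ℝ) ^ t := pow_lt_pow_right₀ hl hrt
  have hzero : ((ℓ : ℝ) ^ t - (ℓ : ℝ) ^ r) * ((ℓ : ℝ) - 1) = 0 := by
    linear_combination (1 + (ℓ : ℝ) ^ r) * h1 - (1 + (ℓ : ℝ) ^ r * ℓ) * h0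
  exact (mul_pos (sub_pos.mpr hlt) (sub_pos.mpr hl)).ne' hzero
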